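/- arXiv:2510.04642 — 6 statements merged into one kernel-verified Lean document; each statement's English description precedes it below -/
import Mathlib

section
/- For every formula φ of the language L, φ is S5G-valid if and only if φ is eF-valid. -/
open scoped Classical

/-- Formulas of the language L over a set `A` of agents, with propositional
variables indexed by `ℕ`. -/
inductive Formula (A : Type) : Type
  | var : ℕ → Formula A
  | neg : Formula A → Formula A
  | and : Formula A → Formula A → Formula A
  | imp : Formula A → Formula A → Formula A
  | box : A → Formula A → Formula A

namespace Formula

/-- `◇ₐφ := ~□ₐ~φ`. -/
def dia {A : Type} (a : A) (φ : Formula A) : Formula A := .neg (.box a (.neg φ))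

/-- `φ ↔ χ := (φ→χ)∧(χ→φ)`. -/
def biImp {A : Type} (φ χ : Formula A) : Formula A := .and (.imp φ χ) (.imp χ φ)

/-- `𝟏 := p → p`. -/
def one {A : Type} : Formula A := .imp (.var 0) (.var 0)

/-- Coimplication `φ ⤙ χ := ~(~χ → ~φ)`. -/
def coimp {A : Type} (φ χ : Formula A) : Formula A := .neg (.imp (.neg χ) (.neg φ))

/-- Baaz Delta `△φ := 𝟏 ⤙ (𝟏 ⤙ φ)`. -/
def tri {A : Type} (φ : Formula A) : Formula A := coimp one (coimp one φ)

/-- `φ^△`: replace every occurrence of every propositional variable `p` by `△p`. -/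
def triSub {A : Type} : Formula A → Formula A
  | .var p => tri (.var p)
  | .neg φ => .neg φ.triSub
  | .and φ χ => .and φ.triSub χ.triSub
  | .imp φ χ => .imp φ.triSub χ.triSub
  | .box a φ => .box a φ.triSub

/-- `ℓ(φ)`: the number of occurrences of symbols in `φ`. -/
def size {A : Type} : Formula A → ℕ
  | .var _ => 1
  | .neg φ => φ.size + 1
  | .and φ χ => φ.size + χ.size + 1
  | .imp φ χ => φ.size + χ.size + 1
  | .box _ φ => φ.size + 1

/-- On every branch of the syntactic tree, the first modal operator encountered
(if any) is not `□ₐ`. -/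
def noUnguardedBox {A : Type} (a : A) : Formula A → Prop
  | .var _ => True
  | .neg φ => φ.noUnguardedBox a
  | .and φ χ => φ.noUnguardedBox a ∧ χ.noUnguardedBox a
  | .imp φ χ => φ.noUnguardedBox a ∧ χ.noUnguardedBox a
  | .box b _ => b ≠ a

/-- A formula is irredundantly nested if in every branch of its syntactic tree,
between any two nodes `□ₐ` there occurs a node `□_{a'}` for some `a' ≠ a`. -/
def IrredundantlyNested {A : Type} : Formula A → Prop
  | .var _ => True
  | .neg φ => φ.IrredundantlyNested
  | .and φ χ => φ.IrredundantlyNested ∧ χ.IrredundantlyNested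
  | .imp φ χ => φ.IrredundantlyNested ∧ χ.IrredundantlyNested
  | .box a φ => φ.noUnguardedBox a ∧ φ.IrredundantlyNested

/-- Auxiliary function for the modal alternation depth: the maximal alternation
number over leaves, where `o` records the agent of the nearest modal ancestor. -/
def aDepth {A : Type} [DecidableEq A] : Formula A → Option A → ℕ
  | .var _, _ => 0
  | .neg φ, o => φ.aDepth o
  | .and φ χ, o => max (φ.aDepth o) (χ.aDepth o)
  | .imp φ χ, o => max (φ.aDepth o) (χ.aDepth o)
  | .box a φ, o => if o = some a then φ.aDepth (some a) else φ.aDepth (some a) + 1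

/-- The modal alternation depth `𝒜(φ)`. -/
def altDepth {A : Type} [DecidableEq A] (φ : Formula A) : ℕ := φ.aDepth none

end Formula

/-- An S5G-model over agents `A` and states `W`: an epistemic frame (nonempty
`W`, each `R a` an equivalence relation) with a `[0,1]`-valued valuation. -/
structure S5GModel (A W : Type) where
  nonempty : Nonempty W
  R : A → W → W → Prop
  equiv : ∀ a, Equivalence (R a)
  val : ℕ → W → ℝ
  val_mem : ∀ p w, val p w ∈ Set.Icc (0 : ℝ) 1

/-- Gödel semantics on S5G-models. -/
noncomputable def S5GModel.v {A W : Type} (M : S5GModel A W) : Formula A → W → ℝ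
  | .var p, w => M.val p w
  | .neg φ, w => 1 - M.v φ w
  | .and φ χ, w => min (M.v φ w) (M.v χ w)
  | .imp φ χ, w => if M.v φ w ≤ M.v χ w then 1 else M.v χ w
  | .box a φ, w => sInf {x : ℝ | ∃ w', M.R a w w' ∧ M.v φ w' = x}

/-- S5G-validity: value `1` at every state of every S5G-model. -/
def S5GValid (A : Type) (φ : Formula A) : Prop :=
  ∀ (W : Type) (M : S5GModel A W) (w : W), M.v φ w = 1

/-- S5G-satisfiability: value `1` at some state of some S5G-model. -/
def S5GSat (A : Type) (φ : Formula A) : Prop :=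
  ∃ (W : Type) (M : S5GModel A W) (w : W), M.v φ w = 1

/-- An epistemic F-model (eF-model). -/
structure EFModel (A W : Type) where
  nonempty : Nonempty W
  R : A → W → W → Prop
  equiv : ∀ a, Equivalence (R a)
  T : A → W → Set ℝ
  T_finite : ∀ a w, (T a w).Finite
  T_sub : ∀ a w, T a w ⊆ Set.Icc (0 : ℝ) 1
  T_zero : ∀ a w, (0 : ℝ) ∈ T a w
  T_half : ∀ a w, (1 / 2 : ℝ) ∈ T a w
  T_one : ∀ a w, (1 : ℝ) ∈ T a w
  T_inv : ∀ a w x, x ∈ T a w → 1 - x ∈ T a w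
  T_R : ∀ a w w', R a w w' → T a w = T a w'
  val : ℕ → W → ℝ
  val_mem : ∀ p w, val p w ∈ Set.Icc (0 : ℝ) 1

/-- Semantics on eF-models: `v(□ₐφ,w)` is the greatest element of `T a w` below
`inf{v(φ,w') : w Rₐ w'}` (rendered via `sSup` of the relevant finite set). -/
noncomputable def EFModel.v {A W : Type} (M : EFModel A W) : Formula A → W → ℝ
  | .var p, w => M.val p w
  | .neg φ, w => 1 - M.v φ w
  | .and φ χ, w => min (M.v φ w) (M.v χ w)
  | .imp φ χ, w => if M.v φ w ≤ M.v χ w then 1 else M.v χ w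
  | .box a φ, w =>
      sSup {x : ℝ | x ∈ M.T a w ∧ x ≤ sInf {y : ℝ | ∃ w', M.R a w w' ∧ M.v φ w' = y}}

/-- eF-validity: value `1` at every state of every eF-model. -/
def EFValid (A : Type) (φ : Formula A) : Prop :=
  ∀ (W : Type) (M : EFModel A W) (w : W), M.v φ w = 1

lemma S5GModel.v_mem {A W : Type} (M : S5GModel A W) (φ : Formula A) (w : W) :
    M.v φ w ∈ Set.Icc (0 : ℝ) 1 := by
  induction φ generalizing w with
  | var p => exact M.val_mem p w
  | neg φ ih =>
    obtain ⟨h0, h1⟩ := ih w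
    exact ⟨by simp only [S5GModel.v]; linarith, by simp only [S5GModel.v]; linarith⟩
  | and φ χ ihφ ihχ =>
    exact ⟨le_min (ihφ w).1 (ihχ w).1, (min_le_left _ _).trans (ihφ w).2⟩
  | imp φ χ ihφ ihχ =>
    simp only [S5GModel.v]
    split_ifs
    · simp
    · exact ihχ w
  | box a φ ih =>
    have hlb : ∀ x ∈ {x : ℝ | ∃ w', M.R a w w' ∧ M.v φ w' = x}, 0 ≤ x := by
      rintro _ ⟨w', -, rfl⟩
      exact (ih w').1
    exact ⟨le_csInf ⟨_, w, (M.equiv a).refl w, rfl⟩ hlb,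
      (csInf_le ⟨0, hlb⟩ ⟨w, (M.equiv a).refl w, rfl⟩).trans (ih w).2⟩

lemma EFModel.box_mem {A W : Type} (M : EFModel A W) (a : A) (φ : Formula A) (w : W)
    (h0 : ∀ w', 0 ≤ M.v φ w') :
    M.v (.box a φ) w ∈
      {x : ℝ | x ∈ M.T a w ∧ x ≤ sInf {y : ℝ | ∃ w', M.R a w w' ∧ M.v φ w' = y}} := by
  refine Set.Nonempty.csSup_mem ⟨0, M.T_zero a w, ?_⟩
    ((M.T_finite a w).subset fun x hx => hx.1)
  refine le_csInf ⟨_, w, (M.equiv a).refl w, rfl⟩ ?_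
  rintro _ ⟨w', -, rfl⟩
  exact h0 w'

lemma EFModel.le_box {A W : Type} (M : EFModel A W) (a : A) (φ : Formula A) (w : W) {x : ℝ}
    (hx : x ∈ M.T a w) (hle : x ≤ sInf {y : ℝ | ∃ w', M.R a w w' ∧ M.v φ w' = y}) :
    x ≤ M.v (.box a φ) w :=
  le_csSup ((M.T_finite a w).subset fun _ hx => hx.1).bddAbove ⟨hx, hle⟩

lemma EFModel.v_mem {A W : Type} (M : EFModel A W) (φ : Formula A) (w : W) :
    M.v φ w ∈ Set.Icc (0 : ℝ) 1 := by
  induction φ generalizing w with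
  | var p => exact M.val_mem p w
  | neg φ ih =>
    obtain ⟨h0, h1⟩ := ih w
    exact ⟨by simp only [EFModel.v]; linarith, by simp only [EFModel.v]; linarith⟩
  | and φ χ ihφ ihχ =>
    exact ⟨le_min (ihφ w).1 (ihχ w).1, (min_le_left _ _).trans (ihφ w).2⟩
  | imp φ χ ihφ ihχ =>
    simp only [EFModel.v]
    split_ifs
    · simp
    · exact ihχ w
  | box a φ ih => exact M.T_sub a w (M.box_mem a φ w fun w' => (ih w').1).1

/-- The bodies of the boxed subformulas of a formula. -/
def Formula.boxBodies {A : Type} : Formula A → Set (Formula A)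
  | .var _ => ∅
  | .neg φ => φ.boxBodies
  | .and φ χ => φ.boxBodies ∪ χ.boxBodies
  | .imp φ χ => φ.boxBodies ∪ χ.boxBodies
  | .box _ φ => insert φ φ.boxBodies

lemma Formula.boxBodies_finite {A : Type} (φ : Formula A) : φ.boxBodies.Finite := by
  induction φ with
  | var p => exact Set.finite_empty
  | neg φ ih => exact ih
  | and φ χ ihφ ihχ => exact ihφ.union ihχ
  | imp φ χ ihφ ihχ => exact ihφ.union ihχ
  | box a φ ih => exact ih.insert φ

lemma S5GModel.box_congr {A W : Type} (M : S5GModel A W) {a : A} (φ : Formula A) {w w' : W}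
    (h : M.R a w w') : M.v (.box a φ) w = M.v (.box a φ) w' := by
  simp only [S5GModel.v]
  congr 1
  ext x
  exact ⟨fun ⟨u, hu, hx⟩ => ⟨u, (M.equiv a).trans ((M.equiv a).symm h) hu, hx⟩,
    fun ⟨u, hu, hx⟩ => ⟨u, (M.equiv a).trans h hu, hx⟩⟩

/-- The eF-model on the frame of an S5G-model whose truth sets collect the values of
`□ₐψ` for `ψ` in a finite set of formulas. -/
noncomputable def S5GModel.toEF {A W : Type} (M : S5GModel A W) (S : Set (Formula A))
    (hS : S.Finite) : EFModel A W where
  nonempty := M.nonempty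
  R := M.R
  equiv := M.equiv
  T a w := {0, 1 / 2, 1} ∪ ((fun ψ => M.v (.box a ψ) w) '' S ∪
    (fun ψ => 1 - M.v (.box a ψ) w) '' S)
  T_finite a w := (by simp : ({0, 1 / 2, 1} : Set ℝ).Finite).union
    ((hS.image _).union (hS.image _))
  T_sub a w := by
    rintro x ((rfl | rfl | rfl) | ⟨ψ, -, rfl⟩ | ⟨ψ, -, rfl⟩)
    · simp
    · norm_num
    · simp
    · exact M.v_mem _ w
    · exact M.v_mem (.neg (.box a ψ)) w
  T_zero a w := by simp
  T_half a w := by simp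
  T_one a w := by simp
  T_inv a w := by
    rintro x ((rfl | rfl | rfl) | ⟨ψ, hψ, rfl⟩ | ⟨ψ, hψ, rfl⟩)
    · simp
    · left; norm_num
    · simp
    · exact Or.inr (Or.inr ⟨ψ, hψ, rfl⟩)
    · exact Or.inr (Or.inl ⟨ψ, hψ, by simp⟩)
  T_R a w w' h := by simp only [M.box_congr _ h]
  val := M.val
  val_mem := M.val_mem

lemma S5GModel.toEF_v {A W : Type} (M : S5GModel A W) (S : Set (Formula A)) (hS : S.Finite)
    (φ : Formula A) (hφ : φ.boxBodies ⊆ S) (w : W) : (M.toEF S hS).v φ w = M.v φ w := by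
  induction φ generalizing w with
  | var p => rfl
  | neg φ ih => simp only [EFModel.v, S5GModel.v, ih hφ]
  | and φ χ ihφ ihχ =>
    simp only [EFModel.v, S5GModel.v, ihφ (Set.subset_union_left.trans hφ),
      ihχ (Set.subset_union_right.trans hφ)]
  | imp φ χ ihφ ihχ =>
    simp only [EFModel.v, S5GModel.v, ihφ (Set.subset_union_left.trans hφ),
      ihχ (Set.subset_union_right.trans hφ)]
  | box a φ ih =>
    simp only [EFModel.v, S5GModel.v, ih ((Set.subset_insert _ _).trans hφ)]
    refine IsGreatest.csSup_eq ⟨⟨?_, le_rfl⟩, fun x hx => hx.2⟩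
    exact Or.inr (Or.inl ⟨φ, hφ (Set.mem_insert _ _), rfl⟩)

/-- The order automorphisms of `ℝ` that fix `0` and commute with `x ↦ 1 - x`; they restrict to
automorphisms of `[0,1]` with its order and involution. -/
def InvAut : Type := {h : ℝ ≃o ℝ // h 0 = 0 ∧ ∀ x, h (1 - x) = 1 - h x}

namespace InvAut

/-- The identity automorphism. -/
def refl : InvAut := ⟨OrderIso.refl ℝ, by simp⟩

lemma map_one (h : InvAut) : h.1 1 = 1 := by
  have := h.2.2 0
  rwa [h.2.1, sub_zero] at this

lemma map_mem (h : InvAut) {x : ℝ} (hx : x ∈ Set.Icc (0 : ℝ) 1) :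
    h.1 x ∈ Set.Icc (0 : ℝ) 1 :=
  ⟨h.2.1.symm.trans_le (h.1.monotone hx.1), (h.1.monotone hx.2).trans_eq h.map_one⟩

end InvAut

/-- An order automorphism of `ℝ` supported in `(t, t')` can push any point of `(t, t')`
arbitrarily close to `t`. -/
lemma exists_orderIso_push_down {t s t' u : ℝ} (hts : t < s) (hst : s < t') (htu : t < u) :
    ∃ k : ℝ ≃o ℝ, (∀ x, x ∉ Set.Ioo t t' → k x = x) ∧ k s < u := by
  obtain ⟨r, htr, hru⟩ := exists_between (lt_min htu hts)
  have hru' : r < u := hru.trans_le (min_le_left _ _)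
  have hrs : r < s := hru.trans_le (min_le_right _ _)
  set α : ℝ := (s - r) / (s - t) with hα
  set β : ℝ := (s - t) / (t' - s) with hβ
  have hα0 : 0 ≤ α := div_nonneg (by linarith) (by linarith)
  have hα1 : α < 1 := by rw [hα, div_lt_one (by linarith)]; linarith
  have hβ0 : 0 < β := div_pos (by linarith) (by linarith)
  set f : ℝ → ℝ := fun x => max 0 (min (x - t) (β * (t' - x))) with hf
  have hf_inc : ∀ x y, x ≤ y → f y - f x ≤ y - x := by
    intro x y hxy
    have h1 : f y ≤ f x + (y - x) := by
      refine max_le (add_nonneg (le_max_left _ _) (by linarith)) ?_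
      have h2 : min (x - t) (β * (t' - x)) ≤ f x := le_max_right _ _
      have h3 : β * (t' - y) ≤ β * (t' - x) :=
        mul_le_mul_of_nonneg_left (by linarith) hβ0.le
      rcases min_cases (x - t) (β * (t' - x)) with h | h
      · have := min_le_left (y - t) (β * (t' - y))
        linarith
      · have := min_le_right (y - t) (β * (t' - y))
        linarith
    linarith
  have hf_out : ∀ x, x ∉ Set.Ioo t t' → f x = 0 := by
    intro x hx
    refine max_eq_left ?_
    rcases le_or_gt x t with h | h
    · exact (min_le_left _ _).trans (by linarith)
    · have h' : t' ≤ x := not_lt.1 fun h' => hx ⟨h, h'⟩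
      exact (min_le_right _ _).trans (mul_nonpos_of_nonneg_of_nonpos hβ0.le (by linarith))
  have hf_s : f s = s - t := by
    have : β * (t' - s) = s - t := div_mul_cancel₀ _ (by linarith)
    simp only [hf, this, min_self]
    exact max_eq_right (by linarith)
  have hmono : StrictMono fun x => x - α * f x := by
    intro x y hxy
    have := mul_le_mul_of_nonneg_left (hf_inc x y hxy.le) hα0
    have := mul_lt_mul_of_pos_right hα1 (sub_pos.2 hxy)
    simp only
    linarith
  have hout : ∀ x, x ∉ Set.Ioo t t' → x - α * f x = x := by
    intro x hx
    rw [hf_out x hx, mul_zero, sub_zero]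
  have hsurj : Function.Surjective fun x => x - α * f x := by
    intro y
    by_cases hy : y ∈ Set.Ioo t t'
    · have hcont : Continuous fun x => x - α * f x := by fun_prop
      have := intermediate_value_Icc (hts.trans hst).le hcont.continuousOn
      obtain ⟨x, -, hx⟩ := this (a := y) (by
        rw [hout t (by simp), hout t' (by simp)]
        exact ⟨hy.1.le, hy.2.le⟩)
      exact ⟨x, hx⟩
    · exact ⟨y, hout y hy⟩
  refine ⟨hmono.orderIsoOfSurjective _ hsurj, hout, ?_⟩
  change s - α * f s < u
  rw [hf_s, hα, div_mul_cancel₀ _ (by linarith)]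
  linarith

lemma OrderIso.apply_mem_Ioo_of_fixed {k : ℝ ≃o ℝ} {t t' : ℝ}
    (hk : ∀ x, x ∉ Set.Ioo t t' → k x = x) {x : ℝ} (hx : x ∈ Set.Ioo t t') :
    k x ∈ Set.Ioo t t' :=
  ⟨hk t (by simp) ▸ k.strictMono hx.1, hk t' (by simp) ▸ k.strictMono hx.2⟩

/-- Version of `exists_orderIso_push_down` compatible with `x ↦ 1 - x`. -/
lemma InvAut.exists_push_down {T : Set ℝ} (h0 : (0 : ℝ) ∈ T) (hhalf : (1 / 2 : ℝ) ∈ T)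
    (hinv : ∀ x ∈ T, 1 - x ∈ T) {t s t' u : ℝ} (hT : ∀ x ∈ T, x ∉ Set.Ioo t t')
    (hts : t < s) (hst : s < t') (htu : t < u) :
    ∃ g : InvAut, (∀ x ∈ T, g.1 x = x) ∧ g.1 s < u := by
  obtain ⟨k, hk, hks⟩ := exists_orderIso_push_down hts hst htu
  have hdisj : ∀ x, x ∈ Set.Ioo t t' → 1 - x ∉ Set.Ioo t t' := fun x hx hx' =>
    hT _ hhalf (by
      rcases le_total x (1 / 2) with h | h
      · exact ⟨by linarith [hx.1], by linarith [hx'.2]⟩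
      · exact ⟨by linarith [hx'.1], by linarith [hx.2]⟩)
  let ι : ℝ → ℝ := fun x => 1 - k (1 - k x)
  have hmem : ∀ x, x ∈ Set.Ioo t t' → k x ∈ Set.Ioo t t' := fun x hx =>
    OrderIso.apply_mem_Ioo_of_fixed hk hx
  have hin : ∀ x, x ∈ Set.Ioo t t' → ι x = k x := by
    intro x hx
    simp only [ι]
    rw [hk _ (hdisj _ (hmem x hx))]
    ring
  have hmirror : ∀ x, x ∉ Set.Ioo t t' → ι x = 1 - k (1 - x) := by
    intro x hx
    simp only [ι]
    rw [hk _ hx]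
  have hmono : StrictMono ι := fun x y hxy =>
    sub_lt_sub_left (k.strictMono (sub_lt_sub_left (k.strictMono hxy) 1)) 1
  have hsurj : Function.Surjective ι := fun y =>
    ⟨k.symm (1 - k.symm (1 - y)), by simp [ι]⟩
  have hfix : ∀ x ∈ T, ι x = x := by
    intro x hx
    rw [hmirror x (hT x hx), hk _ (hT _ (hinv x hx))]
    ring
  refine ⟨⟨hmono.orderIsoOfSurjective _ hsurj, hfix 0 h0, fun x => ?_⟩, hfix, ?_⟩
  · change ι (1 - x) = 1 - ι x
    by_cases hx : x ∈ Set.Ioo t t'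
    · rw [hin x hx, hmirror _ (hdisj x hx), sub_sub_cancel]
    · rw [hmirror x hx, sub_sub_cancel]
      by_cases hx' : 1 - x ∈ Set.Ioo t t'
      · exact hin _ hx'
      · rw [hmirror _ hx', sub_sub_cancel, hk _ hx, hk _ hx']
  · change ι s < u
    rw [hin s ⟨hts, hst⟩]
    exact hks

/-- The S5G-model whose states are the states of an eF-model paired with automorphisms
distorting the values; related states carry automorphisms agreeing on the truth set. -/
def EFModel.toS5G {A W : Type} (M : EFModel A W) : S5GModel A (W × InvAut) where
  nonempty := M.nonempty.map fun w => (w, InvAut.refl)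
  R a p q := M.R a p.1 q.1 ∧ ∀ x ∈ M.T a p.1, q.2.1 x = p.2.1 x
  equiv a :=
    { refl := fun p => ⟨(M.equiv a).refl _, fun _ _ => rfl⟩
      symm := fun h => ⟨(M.equiv a).symm h.1, fun x hx =>
        (h.2 x (by rwa [M.T_R a _ _ h.1])).symm⟩
      trans := fun h h' => ⟨(M.equiv a).trans h.1 h'.1, fun x hx =>
        (h'.2 x (by rwa [← M.T_R a _ _ h.1])).trans (h.2 x hx)⟩ }
  val p q := q.2.1 (M.val p q.1)
  val_mem p q := q.2.map_mem (M.val_mem p q.1)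

/-- For every bound `u` above `v(□ₐφ,w)`, some accessible state and some automorphism fixing
the truth set push the value of `φ` below `u`. -/
lemma EFModel.exists_push_down {A W : Type} (M : EFModel A W) (a : A) (φ : Formula A) (w : W)
    {u : ℝ} (hu : M.v (.box a φ) w < u) :
    ∃ w', M.R a w w' ∧ ∃ g : InvAut, (∀ x ∈ M.T a w, g.1 x = x) ∧ g.1 (M.v φ w') < u := by
  set I : ℝ := sInf {y : ℝ | ∃ w', M.R a w w' ∧ M.v φ w' = y} with hI
  have hne : {y : ℝ | ∃ w', M.R a w w' ∧ M.v φ w' = y}.Nonempty :=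
    ⟨_, w, (M.equiv a).refl w, rfl⟩
  have hlb : ∀ w', M.R a w w' → I ≤ M.v φ w' := fun w' hw' =>
    csInf_le ⟨0, by rintro _ ⟨v, -, rfl⟩; exact (M.v_mem φ v).1⟩ ⟨w', hw', rfl⟩
  have hbox := M.box_mem a φ w fun w' => (M.v_mem φ w').1
  rcases le_or_gt 1 I with h1 | h1
  · refine ⟨w, (M.equiv a).refl w, InvAut.refl, fun _ _ => rfl, ?_⟩
    exact ((M.v_mem φ w).2.trans (M.le_box a φ w (M.T_one a w) h1)).trans_lt hu
  · obtain ⟨t', ⟨ht'T, ht'I⟩, ht'min⟩ := Set.exists_min_image {x | x ∈ M.T a w ∧ I < x} id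
      ((M.T_finite a w).subset fun _ hx => hx.1) ⟨1, M.T_one a w, h1⟩
    obtain ⟨_, ⟨w', hw', rfl⟩, hlt⟩ := exists_lt_of_csInf_lt hne ht'I
    refine ⟨w', hw', ?_⟩
    rcases (hbox.2.trans (hlb w' hw')).eq_or_lt with heq | hgt
    · exact ⟨InvAut.refl, fun _ _ => rfl, heq ▸ hu⟩
    · refine InvAut.exists_push_down (M.T_zero a w) (M.T_half a w) (M.T_inv a w)
        (fun x hx hxI => ?_) hgt hlt hu
      rcases le_or_gt x I with h | h
      · exact (M.le_box a φ w hx h).not_gt hxI.1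
      · exact (ht'min x ⟨hx, h⟩).not_gt hxI.2

lemma EFModel.toS5G_v {A W : Type} (M : EFModel A W) (φ : Formula A) (w : W) (h : InvAut) :
    M.toS5G.v φ (w, h) = h.1 (M.v φ w) := by
  induction φ generalizing w h with
  | var p => rfl
  | neg φ ih => simp only [EFModel.v, S5GModel.v, ih, h.2.2]
  | and φ χ ihφ ihχ => simp only [EFModel.v, S5GModel.v, ihφ, ihχ, h.1.monotone.map_min]
  | imp φ χ ihφ ihχ =>
    simp only [EFModel.v, S5GModel.v, ihφ, ihχ, h.1.le_iff_le]
    split_ifs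
    · exact h.map_one.symm
    · rfl
  | box a φ ih =>
    have hbox := M.box_mem a φ w fun w' => (M.v_mem φ w').1
    have hlb : ∀ x ∈ {x : ℝ | ∃ q, M.toS5G.R a (w, h) q ∧ M.toS5G.v φ q = x},
        h.1 (M.v (.box a φ) w) ≤ x := by
      rintro _ ⟨⟨w', h'⟩, ⟨hw', hh'⟩, rfl⟩
      rw [ih, ← hh' _ hbox.1]
      refine h'.1.monotone (hbox.2.trans (csInf_le ⟨0, ?_⟩ ⟨w', hw', rfl⟩))
      rintro _ ⟨v, -, rfl⟩
      exact (M.v_mem φ v).1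
    refine csInf_eq_of_forall_ge_of_forall_gt_exists_lt
      ⟨_, (w, h), (M.toS5G.equiv a).refl _, rfl⟩ hlb fun y hy => ?_
    obtain ⟨w', hw', g, hg, hgu⟩ := M.exists_push_down a φ w (u := h.1.symm y)
      (h.1.lt_symm_apply.2 hy)
    let h' : InvAut := ⟨g.1.trans h.1, by simp [g.2.1, h.2.1], fun x => by simp [g.2.2, h.2.2]⟩
    refine ⟨_, ⟨(w', h'), ⟨hw', fun x hx => congrArg h.1 (hg x hx)⟩, rfl⟩, ?_⟩
    rw [ih]
    exact h.1.lt_symm_apply.1 hgu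

/-- a formula is S5G-valid iff it is eF-valid. -/
theorem stmt0 (A : Type) [Fintype A] [Nonempty A] (φ : Formula A) :
    S5GValid A φ ↔ EFValid A φ := by
  constructor
  · intro hφ W M w
    have := hφ _ M.toS5G (w, InvAut.refl)
    rwa [M.toS5G_v] at this
  · intro hφ W M w
    rw [← M.toEF_v φ.boxBodies φ.boxBodies_finite φ subset_rfl w]
    exact hφ W _ w
end

section
/- A formula φ of the language L is valid on all eF-models if and only if it is valid on all eF-models whose set of states W is finite. -/
open scoped Classical

/-- The pairs `(a, ψ)` such that `□ₐψ` is a subformula. -/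
def Formula.boxes {A : Type} : Formula A → Set (A × Formula A)
  | .var _ => ∅
  | .neg φ => φ.boxes
  | .and φ χ => φ.boxes ∪ χ.boxes
  | .imp φ χ => φ.boxes ∪ χ.boxes
  | .box a φ => insert (a, φ) φ.boxes

theorem Formula.finite_boxes {A : Type} (φ : Formula A) : φ.boxes.Finite := by
  induction φ with
  | var _ => exact Set.finite_empty
  | neg _ ih => exact ih
  | and _ _ ih₁ ih₂ => exact ih₁.union ih₂
  | imp _ _ ih₁ ih₂ => exact ih₁.union ih₂
  | box _ _ ih => exact ih.insert _

namespace EFModel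

variable {A W : Type} (M : EFModel A W)

theorem v_mem_Icc (φ : Formula A) (w : W) : M.v φ w ∈ Set.Icc (0 : ℝ) 1 := by
  induction φ generalizing w with
  | var p => exact M.val_mem p w
  | neg φ ih =>
    have := ih w
    simp only [v, Set.mem_Icc] at this ⊢
    constructor <;> linarith
  | and φ χ ih₁ ih₂ =>
    exact ⟨le_min (ih₁ w).1 (ih₂ w).1, (min_le_left _ _).trans (ih₁ w).2⟩
  | imp φ χ ih₁ ih₂ =>
    simp only [v]
    split_ifs
    · simp
    · exact ih₂ w
  | box a φ ih =>
    exact ⟨Real.sSup_nonneg fun x hx => (M.T_sub a w hx.1).1,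
      Real.sSup_le (fun x hx => (M.T_sub a w hx.1).2) zero_le_one⟩

theorem v_box (a : A) (φ : Formula A) (w : W) :
    M.v (.box a φ) w = sSup {x | x ∈ M.T a w ∧ ∀ w', M.R a w w' → x ≤ M.v φ w'} := by
  simp only [v]
  congr 1
  ext x
  refine and_congr_right fun _ => ?_
  have hbdd : BddBelow {y : ℝ | ∃ w', M.R a w w' ∧ M.v φ w' = y} := by
    refine ⟨0, ?_⟩
    rintro _ ⟨w', -, rfl⟩
    exact (M.v_mem_Icc φ w').1
  have hne : {y : ℝ | ∃ w', M.R a w w' ∧ M.v φ w' = y}.Nonempty :=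
    ⟨_, w, (M.equiv a).refl w, rfl⟩
  rw [le_csInf_iff hbdd hne]
  constructor
  · exact fun h w' hw' => h _ ⟨w', hw', rfl⟩
  · rintro h _ ⟨w', hw', rfl⟩
    exact h w' hw'

/-- Finiteness of `T a w` lets a single accessible state determine the value of `□ₐφ`. -/
theorem exists_witness (a : A) (φ : Formula A) (w : W) :
    ∃ u, M.R a w u ∧ ∀ x ∈ M.T a w, x ≤ M.v φ u → ∀ w', M.R a w w' → x ≤ M.v φ w' := by
  let F := {x ∈ M.T a w | ¬ ∀ w', M.R a w w' → x ≤ M.v φ w'}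
  have hF : F.Finite := (M.T_finite a w).subset (Set.sep_subset _ _)
  rcases F.eq_empty_or_nonempty with h | h
  · refine ⟨w, (M.equiv a).refl w, fun x hx _ => ?_⟩
    by_contra hc
    exact Set.notMem_empty x (h ▸ (⟨hx, hc⟩ : x ∈ F))
  · obtain ⟨m, hm, hmin⟩ := Set.exists_min_image F id hF h
    obtain ⟨-, hmw⟩ := id hm
    push Not at hmw
    obtain ⟨u, hu, hlt⟩ := hmw
    refine ⟨u, hu, fun x hx hxu => ?_⟩
    by_contra hc
    exact absurd (hmin x ⟨hx, hc⟩) (not_le.2 (hxu.trans_lt hlt))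

/-- A state witnessing the value of `□ₐφ` at `w`. -/
noncomputable def witness (e : A × Formula A) (w : W) : W := (M.exists_witness e.1 e.2 w).choose

theorem R_witness (e : A × Formula A) (w : W) : M.R e.1 w (M.witness e w) :=
  (M.exists_witness e.1 e.2 w).choose_spec.1

theorem le_of_le_v_witness (e : A × Formula A) {w w' : W} {x : ℝ} (hx : x ∈ M.T e.1 w)
    (h : x ≤ M.v e.2 (M.witness e w)) (hw : M.R e.1 w w') : x ≤ M.v e.2 w' :=
  (M.exists_witness e.1 e.2 w).choose_spec.2 x hx h w' hw

/-- The state reached from `w` by following the witnesses listed in `l`, last entry first. -/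
noncomputable def follow {s : Set (A × Formula A)} (w : W) : List s → W
  | [] => w
  | e :: l => M.witness e (follow w l)

/-- The node representing the `a`-cluster of `l` in the tree of witnesses. -/
noncomputable def clusterRoot {s : Set (A × Formula A)} (a : A) : List s → List s
  | [] => []
  | e :: l => if e.1.1 = a then l else e :: l

section Tree

variable {s : Set (A × Formula A)}

theorem length_clusterRoot_le (a : A) (l : List s) : (clusterRoot a l).length ≤ l.length := by
  cases l with
  | nil => simp [clusterRoot]
  | cons e l =>
    simp only [clusterRoot]
    split_ifs <;> simp

theorem length_le_length_clusterRoot_succ (a : A) (l : List s) :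
    l.length ≤ (clusterRoot a l).length + 1 := by
  cases l with
  | nil => simp
  | cons e l =>
    simp only [clusterRoot]
    split_ifs <;> simp

theorem R_follow_clusterRoot (w : W) (a : A) (l : List s) :
    M.R a (M.follow w (clusterRoot a l)) (M.follow w l) := by
  cases l with
  | nil => exact (M.equiv a).refl _
  | cons e l =>
    simp only [clusterRoot]
    split_ifs with h
    · subst h
      exact M.R_witness e.1 _
    · exact (M.equiv a).refl _

theorem R_follow_of_clusterRoot_eq (w : W) {a : A} {l l' : List s}
    (h : clusterRoot a l = clusterRoot a l') : M.R a (M.follow w l) (M.follow w l') :=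
  (M.equiv a).trans ((M.equiv a).symm (M.R_follow_clusterRoot w a l))
    (h ▸ M.R_follow_clusterRoot w a l')

/-- The model on the tree of witnesses of depth at most `n` rooted at `w`. -/
noncomputable def treeModel (s : Set (A × Formula A)) (n : ℕ) (w : W) :
    EFModel A {l : List s // l.length ≤ n} where
  nonempty := ⟨⟨[], Nat.zero_le n⟩⟩
  R a l l' := clusterRoot a l.1 = clusterRoot a l'.1
  equiv _ := ⟨fun _ => rfl, Eq.symm, Eq.trans⟩
  T a l := M.T a (M.follow w l.1)
  T_finite _ _ := M.T_finite _ _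
  T_sub _ _ := M.T_sub _ _
  T_zero _ _ := M.T_zero _ _
  T_half _ _ := M.T_half _ _
  T_one _ _ := M.T_one _ _
  T_inv _ _ := M.T_inv _ _
  T_R a _ _ h := M.T_R a _ _ (M.R_follow_of_clusterRoot_eq w h)
  val p l := M.val p (M.follow w l.1)
  val_mem _ _ := M.val_mem _ _

theorem v_treeModel (n : ℕ) (w : W) (φ : Formula A) (hφ : φ.boxes ⊆ s)
    (l : {l : List s // l.length ≤ n}) (hl : l.1.length + φ.size ≤ n) :
    (M.treeModel s n w).v φ l = M.v φ (M.follow w l.1) := by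
  induction φ generalizing l with
  | var p => rfl
  | neg φ ih =>
    simp only [Formula.size] at hl
    simp only [v, ih hφ l (by omega)]
  | and φ χ ih₁ ih₂ =>
    obtain ⟨h₁, h₂⟩ := Set.union_subset_iff.1 hφ
    simp only [Formula.size] at hl
    simp only [v, ih₁ h₁ l (by omega), ih₂ h₂ l (by omega)]
  | imp φ χ ih₁ ih₂ =>
    obtain ⟨h₁, h₂⟩ := Set.union_subset_iff.1 hφ
    simp only [Formula.size] at hl
    simp only [v, ih₁ h₁ l (by omega), ih₂ h₂ l (by omega)]
  | box a φ ih =>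
    obtain ⟨h₁, h₂⟩ := Set.insert_subset_iff.1 hφ
    simp only [Formula.size] at hl
    have key (l' : {l : List s // l.length ≤ n})
        (h : clusterRoot a l.1 = clusterRoot a l'.1) :
        (M.treeModel s n w).v φ l' = M.v φ (M.follow w l'.1) := by
      refine ih h₂ l' ?_
      have := length_clusterRoot_le a l.1
      have := length_le_length_clusterRoot_succ a l'.1
      rw [← h] at this
      omega
    rw [v_box, v_box]
    congr 1
    ext x
    refine and_congr_right fun (hx : x ∈ M.T a (M.follow w l.1)) => ⟨fun h w' hw' => ?_,
      fun h l' hl' => key l' hl' ▸ h _ (M.R_follow_of_clusterRoot_eq w hl')⟩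
    have hroot := M.R_follow_clusterRoot w a l.1
    let l' : {l : List s // l.length ≤ n} := ⟨⟨(a, φ), h₁⟩ :: clusterRoot a l.1, by
      have := length_clusterRoot_le a l.1
      simp only [List.length_cons]
      omega⟩
    have hl' : clusterRoot a l.1 = clusterRoot a l'.1 := by simp [l', clusterRoot]
    refine M.le_of_le_v_witness (a, φ) (w := M.follow w (clusterRoot a l.1)) ?_ ?_
      ((M.equiv a).trans hroot hw')
    · exact (M.T_R a _ _ hroot).symm ▸ hx
    · exact (key l' hl') ▸ h l' hl'

end Tree

end EFModel

/-- a formula is valid on all eF-models iff it is valid on all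
eF-models with a finite set of states. -/
theorem stmt1 (A : Type) [Fintype A] [Nonempty A] (φ : Formula A) :
    EFValid A φ ↔ ∀ (W : Type) (M : EFModel A W), Finite W → ∀ w : W, M.v φ w = 1 := by
  refine ⟨fun h W M _ w => h W M w, fun h W M w => ?_⟩
  have := φ.finite_boxes.to_subtype
  rw [← h _ (M.treeModel φ.boxes φ.size w) (List.finite_length_le _ _) ⟨[], Nat.zero_le _⟩]
  exact (M.v_treeModel _ w φ subset_rfl ⟨[], Nat.zero_le _⟩ (by simp)).symm
end

section
/- Let a and b be two distinct agents and p a propositional variable. The formula (□ₐ(~p→p) ∧ ◇ₐp) → ◇_b p is not S5G-valid: there is an S5G-model and a state at which its value is strictly less than 1 (e.g., the three-state model with states w₀,w₁,w₂, R_a identifying w₀ and w₂, R_b identifying w₀ and w₁, v(p,w₀)=v(p,w₁)=1/2, v(p,w₂)=1, at which the formula has value 1/2). -/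
open scoped Classical

/-- The model with two states, told apart by `b` only, in which every variable
has value `1 / 2` at `false` and `1` at `true`. -/
noncomputable def twoStateModel (A : Type) (b : A) : S5GModel A Bool where
  nonempty := ⟨false⟩
  R c x y := c = b → x = y
  equiv c :=
    { refl := fun _ _ => rfl
      symm := fun h hc => (h hc).symm
      trans := fun h h' hc => (h hc).trans (h' hc) }
  val _ x := if x then 1 else 1 / 2
  val_mem _ x := by cases x <;> norm_num

/-- The value of a box is the value at a related state where it is least. -/
theorem S5GModel.v_box_eq_of_isLeast {A W : Type} (M : S5GModel A W) {a : A}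
    {φ : Formula A} {w u : W} (hu : M.R a w u)
    (h : ∀ w', M.R a w w' → M.v φ u ≤ M.v φ w') : M.v (.box a φ) w = M.v φ u := by
  rw [S5GModel.v]
  refine IsLeast.csInf_eq ⟨⟨u, hu, rfl⟩, ?_⟩
  rintro _ ⟨w', hw', rfl⟩
  exact h w' hw'

/-- `(□ₐ(~p→p) ∧ ◇ₐp) → ◇_b p` is not S5G-valid. -/
theorem stmt7 (A : Type) [Fintype A] (a b : A) (hab : a ≠ b) (p : ℕ) :
    ∃ (W : Type) (M : S5GModel A W) (w : W),
      M.v (.imp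
        (.and (.box a (.imp (.neg (.var p)) (.var p))) (Formula.dia a (.var p)))
        (Formula.dia b (.var p))) w < 1 := by
  refine ⟨Bool, twoStateModel A b, false, ?_⟩
  have hbox : (twoStateModel A b).v (.box a (.imp (.neg (.var p)) (.var p))) false = 1 := by
    rw [S5GModel.v_box_eq_of_isLeast (u := false)]
    · norm_num [S5GModel.v, twoStateModel]
    · exact fun h => absurd h hab
    · rintro (_ | _) _ <;> norm_num [S5GModel.v, twoStateModel]
  have ha : (twoStateModel A b).v (Formula.dia a (.var p)) false = 1 := by
    rw [Formula.dia, S5GModel.v, S5GModel.v_box_eq_of_isLeast (u := true)]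
    · norm_num [S5GModel.v, twoStateModel]
    · exact fun h => absurd h hab
    · rintro (_ | _) _ <;> norm_num [S5GModel.v, twoStateModel]
  have hb : (twoStateModel A b).v (Formula.dia b (.var p)) false = 1 / 2 := by
    rw [Formula.dia, S5GModel.v, S5GModel.v_box_eq_of_isLeast (u := false)]
    · norm_num [S5GModel.v, twoStateModel]
    · exact fun _ => rfl
    · intro w' h
      rw [← h rfl]
  rw [S5GModel.v, S5GModel.v, hbox, ha, hb]
  norm_num
end

section
/- For any agent a and propositional variable p, the formula ◇ₐ(~p→p) → ◇ₐp is not S5G-valid: there exist an S5G-model and a state at which its value is strictly less than 1. -/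
open scoped Classical

/-- `◇ₐ(~p→p) → ◇ₐp` is not S5G-valid. -/
theorem stmt9 (A : Type) [Fintype A] [Nonempty A] (a : A) (p : ℕ) :
    ∃ (W : Type) (M : S5GModel A W) (w : W),
      M.v (.imp (Formula.dia a (.imp (.neg (.var p)) (.var p)))
        (Formula.dia a (.var p))) w < 1 := by
  let M : S5GModel A Unit :=
    { nonempty := ⟨()⟩
      R := fun _ _ _ => True
      equiv := fun _ => ⟨fun _ => trivial, fun _ => trivial, fun _ _ => trivial⟩
      val := fun _ _ => 1 / 2
      val_mem := fun _ _ => ⟨by norm_num, by norm_num⟩ }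
  have h_dia (φ : Formula A) : M.v (Formula.dia a φ) () = M.v φ () := by
    have h_set : {x : ℝ | ∃ w', M.R a () w' ∧ 1 - M.v φ w' = x} = {1 - M.v φ ()} := by
      ext x
      exact ⟨fun ⟨_, _, h⟩ => h.symm, fun h => ⟨(), trivial, h.symm⟩⟩
    simp only [Formula.dia, S5GModel.v, h_set, csInf_singleton, sub_sub_cancel]
  refine ⟨Unit, M, (), ?_⟩
  rw [S5GModel.v, h_dia, h_dia]
  simp only [S5GModel.v, M]
  norm_num
end

section
/- Let M = ⟨W,(R_a)_{a∈A},v⟩ be a classical S5 Kripke model, i.e., ⟨W,(R_a)⟩ is an epistemic frame and v : Prop × W → {0,1} is extended by the classical semantics (negation, conjunction, material implication, and v(□ₐφ,w)=1 iff v(φ,w')=1 for all w' with w R_a w'). Define the eF-model M^△ = ⟨W,(R_a),(T_a^△),v^△⟩ with T_a^△(w) = {0,1/2,1} for all a,w and v^△(p,w)=v(p,w) (viewing 0,1 ∈ [0,1]). For a formula φ of L, let φ^△ be the result of replacing every occurrence of every propositional variable p in φ with △p. Then v^△(φ^△,w) = v(φ,w) for every formula φ of L and every state w. -/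
open scoped Classical

/-- A classical S5 Kripke model: an epistemic frame with a two-valued valuation. -/
structure ClassicalModel (A W : Type) where
  nonempty : Nonempty W
  R : A → W → W → Prop
  equiv : ∀ a, Equivalence (R a)
  val : ℕ → W → Bool

/-- Classical Kripke semantics (truth at a state). -/
def ClassicalModel.v {A W : Type} (M : ClassicalModel A W) : Formula A → W → Prop
  | .var p, w => M.val p w = true
  | .neg φ, w => ¬ M.v φ w
  | .and φ χ, w => M.v φ w ∧ M.v χ w
  | .imp φ χ, w => M.v φ w → M.v χ w
  | .box a φ, w => ∀ w', M.R a w w' → M.v φ w'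

/-- `△` takes value `1` on formulas of value `1` and value `0` on all others of value at most `1`. -/
theorem EFModel.v_tri {A W : Type} (M : EFModel A W) (φ : Formula A) (w : W)
    (hle : M.v φ w ≤ 1) : M.v φ.tri w = if M.v φ w = 1 then (1 : ℝ) else 0 := by
  by_cases h : M.v φ w = 1
  · simp [Formula.tri, Formula.coimp, Formula.one, EFModel.v, h]
  · have hlt : ¬ 1 ≤ M.v φ w := fun h' => h (le_antisymm hle h')
    simp [Formula.tri, Formula.coimp, Formula.one, EFModel.v, h, hlt]

/-- On a formula that only takes the values `0` and `1`, `□ₐ` behaves classically. -/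
theorem EFModel.v_box_of_two_valued {A W : Type} (M : EFModel A W) (a : A) (φ : Formula A)
    (P : W → Prop) (hP : ∀ w, M.v φ w = if P w then (1 : ℝ) else 0) (w : W) :
    M.v (.box a φ) w = if ∀ w', M.R a w w' → P w' then (1 : ℝ) else 0 := by
  have hw : M.R a w w := (M.equiv a).refl w
  rw [EFModel.v]
  split_ifs with h
  · have hset : {y : ℝ | ∃ w', M.R a w w' ∧ M.v φ w' = y} = {1} := by
      ext y
      constructor
      · rintro ⟨w', hw', rfl⟩
        simp [hP, h w' hw']
      · rintro rfl
        exact ⟨w, hw, by simp [hP, h w hw]⟩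
    rw [hset, csInf_singleton]
    exact IsGreatest.csSup_eq ⟨⟨M.T_one a w, le_rfl⟩, fun x hx => hx.2⟩
  · push Not at h
    obtain ⟨u, hu, hPu⟩ := h
    have hinf : sInf {y : ℝ | ∃ w', M.R a w w' ∧ M.v φ w' = y} = 0 := by
      refine IsLeast.csInf_eq ⟨⟨u, hu, by simp [hP, hPu]⟩, ?_⟩
      rintro y ⟨w', -, rfl⟩
      rw [hP]
      split_ifs <;> norm_num
    rw [hinf]
    exact IsGreatest.csSup_eq ⟨⟨M.T_zero a w, le_rfl⟩, fun x hx => hx.2⟩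

/-- from a classical S5 model `M` to the eF-model `M^△` (with
`T_a ≡ {0,1/2,1}` and the same two-valued valuation): `v^△(φ^△,w) = v(φ,w)`. -/
theorem stmt11 (A W : Type) [Fintype A] [Nonempty A]
    (M : ClassicalModel A W) (M' : EFModel A W)
    (hR : M'.R = M.R)
    (hT : ∀ a w, M'.T a w = {0, 1 / 2, 1})
    (hval : ∀ p w, M'.val p w = if M.val p w then 1 else 0) :
    ∀ (φ : Formula A) (w : W), M'.v φ.triSub w = if M.v φ w then (1 : ℝ) else 0 := by
  intro φ
  induction φ with
  | var p =>
    intro w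
    rw [Formula.triSub, M'.v_tri (.var p) w (M'.val_mem p w).2]
    by_cases h : M.val p w = true <;> simp [EFModel.v, ClassicalModel.v, hval, h]
  | neg φ ih =>
    intro w
    by_cases h : M.v φ w <;> simp [Formula.triSub, EFModel.v, ClassicalModel.v, ih, h]
  | and φ χ ihφ ihχ =>
    intro w
    by_cases h : M.v φ w <;> by_cases h' : M.v χ w <;>
      simp [Formula.triSub, EFModel.v, ClassicalModel.v, ihφ, ihχ, h, h']
  | imp φ χ ihφ ihχ =>
    intro w
    by_cases h : M.v φ w <;> by_cases h' : M.v χ w <;>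
      simp [Formula.triSub, EFModel.v, ClassicalModel.v, ihφ, ihχ, h, h']
  | box a φ ih =>
    intro w
    rw [Formula.triSub, M'.v_box_of_two_valued a φ.triSub (M.v φ) ih w, hR]
    simp only [ClassicalModel.v]
    congr
end

section
/- For any agent a and any formulas χ, ψ of the language L, both □ₐ(χ→◇ₐψ) ↔ (◇ₐχ→◇ₐψ) and □ₐ(◇ₐχ→ψ) ↔ (◇ₐχ→□ₐψ) are S5G-valid. -/
open scoped Classical

namespace S5GModel

variable {A W : Type} (M : S5GModel A W)

theorem v_mem_s17 (φ : Formula A) (w : W) : M.v φ w ∈ Set.Icc (0 : ℝ) 1 := by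
  induction φ generalizing w with
  | var p => exact M.val_mem p w
  | neg φ ih =>
    have h := ih w
    simp only [v, Set.mem_Icc] at h ⊢
    constructor <;> linarith
  | and φ χ ih₁ ih₂ =>
    exact ⟨le_min (ih₁ w).1 (ih₂ w).1, (min_le_left _ _).trans (ih₁ w).2⟩
  | imp φ χ _ ih₂ =>
    simp only [v]
    split_ifs
    · simp
    · exact ih₂ w
  | box a φ ih =>
    have hw : M.v φ w ∈ {x : ℝ | ∃ w', M.R a w w' ∧ M.v φ w' = x} :=
      ⟨w, (M.equiv a).refl w, rfl⟩
    refine ⟨le_csInf ⟨_, hw⟩ ?_, (csInf_le ⟨0, ?_⟩ hw).trans (ih w).2⟩ <;>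
      · rintro _ ⟨w', -, rfl⟩
        exact (ih w').1

theorem le_v_box_iff {a : A} {φ : Formula A} {w : W} {t : ℝ} :
    t ≤ M.v (.box a φ) w ↔ ∀ w', M.R a w w' → t ≤ M.v φ w' := by
  rw [v, le_csInf_iff]
  · exact ⟨fun h w' hw' => h _ ⟨w', hw', rfl⟩, by rintro h _ ⟨w', hw', rfl⟩; exact h w' hw'⟩
  · refine ⟨0, ?_⟩
    rintro _ ⟨w', -, rfl⟩
    exact (M.v_mem_s17 φ w').1
  · exact ⟨_, w, (M.equiv a).refl w, rfl⟩

theorem v_dia_le_iff {a : A} {φ : Formula A} {w : W} {t : ℝ} :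
    M.v (.dia a φ) w ≤ t ↔ ∀ w', M.R a w w' → M.v φ w' ≤ t := by
  rw [Formula.dia, v, sub_le_comm, le_v_box_iff]
  simp only [v, sub_le_sub_iff_left]

theorem v_dia_congr {a : A} (φ : Formula A) {w w' : W} (h : M.R a w w') :
    M.v (.dia a φ) w' = M.v (.dia a φ) w := by
  refine eq_of_forall_ge_iff fun t => ?_
  simp only [v_dia_le_iff]
  exact ⟨fun H u hu => H u ((M.equiv a).trans ((M.equiv a).symm h) hu),
    fun H u hu => H u ((M.equiv a).trans h hu)⟩

theorem le_v_imp_iff {φ χ : Formula A} {w : W} {t : ℝ} :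
    t ≤ M.v (.imp φ χ) w ↔ t ≤ 1 ∧ (t ≤ M.v χ w ∨ M.v φ w ≤ M.v χ w) := by
  have h := (M.v_mem_s17 χ w).2
  simp only [v]
  split_ifs with hle
  · simp [hle]
  · simp only [hle, or_false]
    exact ⟨fun ht => ⟨ht.trans h, ht⟩, And.right⟩

theorem v_biImp_of_eq {φ χ : Formula A} {w : W} (h : M.v φ w = M.v χ w) :
    M.v (φ.biImp χ) w = 1 := by
  simp [Formula.biImp, v, h]

theorem v_box_imp_dia (a : A) (χ ψ : Formula A) (w : W) :
    M.v (.box a (.imp χ (.dia a ψ))) w = M.v (.imp (.dia a χ) (.dia a ψ)) w := by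
  refine eq_of_forall_le_iff fun t => ?_
  rw [le_v_box_iff, le_v_imp_iff, v_dia_le_iff (φ := χ)]
  have hw := (M.equiv a).refl w
  constructor
  · intro h
    refine ⟨(M.le_v_imp_iff.1 (h w hw)).1, or_iff_not_imp_left.2 fun ht w' hw' => ?_⟩
    have h' := (M.le_v_imp_iff.1 (h w' hw')).2
    rw [M.v_dia_congr ψ hw'] at h'
    exact h'.resolve_left ht
  · rintro ⟨h₁, h₂⟩ w' hw'
    rw [le_v_imp_iff, M.v_dia_congr ψ hw']
    exact ⟨h₁, h₂.imp_right fun h => h w' hw'⟩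

theorem v_box_dia_imp (a : A) (χ ψ : Formula A) (w : W) :
    M.v (.box a (.imp (.dia a χ) ψ)) w = M.v (.imp (.dia a χ) (.box a ψ)) w := by
  refine eq_of_forall_le_iff fun t => ?_
  rw [le_v_box_iff, le_v_imp_iff, le_v_box_iff, le_v_box_iff]
  have hw := (M.equiv a).refl w
  constructor
  · intro h
    have h' : ∀ w', M.R a w w' → t ≤ M.v ψ w' ∨ M.v (.dia a χ) w ≤ M.v ψ w' := by
      intro w' hw'
      rw [← M.v_dia_congr χ hw']
      exact (M.le_v_imp_iff.1 (h w' hw')).2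
    refine ⟨(M.le_v_imp_iff.1 (h w hw)).1, ?_⟩
    rcases le_total t (M.v (.dia a χ) w) with ht | ht
    · exact .inl fun w' hw' => (h' w' hw').elim id ht.trans
    · exact .inr fun w' hw' => (h' w' hw').elim ht.trans id
  · rintro ⟨h₁, h₂⟩ w' hw'
    rw [le_v_imp_iff, M.v_dia_congr χ hw']
    exact ⟨h₁, h₂.imp (fun h => h w' hw') fun h => h w' hw'⟩

end S5GModel

/-- `□ₐ(χ→◇ₐψ) ↔ (◇ₐχ→◇ₐψ)` and `□ₐ(◇ₐχ→ψ) ↔ (◇ₐχ→□ₐψ)` are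
S5G-valid. -/
theorem stmt17 (A : Type) [Fintype A] [Nonempty A] (a : A) (χ ψ : Formula A) :
    S5GValid A ((Formula.box a (.imp χ (Formula.dia a ψ))).biImp
      (.imp (Formula.dia a χ) (Formula.dia a ψ))) ∧
    S5GValid A ((Formula.box a (.imp (Formula.dia a χ) ψ)).biImp
      (.imp (Formula.dia a χ) (Formula.box a ψ))) :=
  ⟨fun _ M w => M.v_biImp_of_eq (M.v_box_imp_dia a χ ψ w),
    fun _ M w => M.v_biImp_of_eq (M.v_box_dia_imp a χ ψ w)⟩
end
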